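/- Let a be a non-negative integer, b a positive integer, s an integer with s > b, and s₁,…,s_a ∈ ℂ with Re(s+s_{a−k+1}+⋯+s_a) > k+b for k = 1,…,a. Then G_q^{(a,b)}(s₁,…,s_a;s) = Σ ζ_q(s₁,…,s_a,m₁,…,m_b), where the sum ranges over all tuples (m₁,…,m_b) of positive integers with m₁+⋯+m_b = s and m_b ≥ 2 (each ζ_q being given by its absolutely convergent series). -/

import Mathlib

open Complex

/-- The `q`-analogue `[n]_q = (1 - q^n)/(1 - q)` of a natural number `n`. -/
noncomputable def qnum (q : ℝ) (n : ℕ) : ℝ := (1 - q ^ n) / (1 - q)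

/-- The general term `∏_j q^{(s_j−1)n_j}/[n_j]_q^{s_j}` of the `q`-multiple zeta series. -/
noncomputable def zetaTerm (q : ℝ) {r : ℕ} (s : Fin r → ℂ) (n : Fin r → ℕ) : ℂ :=
  ∏ j, (q : ℂ) ^ ((s j - 1) * (n j : ℂ)) / ((qnum q (n j) : ℂ) ^ (s j))

/-- Strictly increasing `r`-tuples of positive integers `0 < n₁ < ⋯ < n_r`. -/
def qIdx (r : ℕ) : Type := {n : Fin r → ℕ // StrictMono n ∧ ∀ j, 0 < n j}

/-- The `q`-multiple zeta function of depth `r`, given by its series. -/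
noncomputable def qMZF (q : ℝ) {r : ℕ} (s : Fin r → ℂ) : ℂ :=
  ∑' n : qIdx r, zetaTerm q s n.1

/-- `Gq q b a sv s` is the function `G_q^{(a,b)}(s₁,…,s_a; s)`, defined inductively by
`G_q^{(a,1)}(s₁,…,s_a;s) = ζ_q(s₁,…,s_a,s)` and, for `b ≥ 2`,
`G_q^{(a,b)}(s₁,…,s_a;s) = Σ_{n≥0} G_q^{(a+1,b−1)}(s₁,…,s_a,s−n−b;n+b)
  − Σ_{n≥0} G_q^{(a+1,b−1)}(s₁,…,s_a,−n;s+n)`. -/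
noncomputable def Gq (q : ℝ) : (b : ℕ) → (a : ℕ) → (Fin a → ℂ) → ℂ → ℂ
  | 0, _, _, _ => 0
  | 1, _a, sv, s => qMZF q (Fin.snoc sv s)
  | (b + 2), a, sv, s =>
      (∑' n : ℕ, Gq q (b + 1) (a + 1)
          (Fin.snoc sv (s - (n : ℂ) - ((b : ℂ) + 2))) ((n : ℂ) + ((b : ℂ) + 2))) -
      ∑' n : ℕ, Gq q (b + 1) (a + 1) (Fin.snoc sv (-(n : ℂ))) (s + (n : ℂ))

/-- The tail `∑_{j ≥ i} c j` of a finite sequence. -/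
noncomputable def tailSum {r : ℕ} (c : Fin r → ℝ) (i : Fin r) : ℝ :=
  ∑ j, if i ≤ j then c j else 0

lemma tailSum_zero {r : ℕ} (c : Fin (r + 1) → ℝ) : tailSum c 0 = ∑ j, c j := by
  simp [tailSum]

lemma tailSum_succ {r : ℕ} (c : Fin (r + 1) → ℝ) (i : Fin r) :
    tailSum c i.succ = tailSum (fun j => c j.succ) i := by
  simp [tailSum, Fin.sum_univ_succ]

lemma tailSum_append_castAdd {r k : ℕ} (c : Fin r → ℝ) (d : Fin k → ℝ) (i : Fin r) :
    tailSum (Fin.append c d) (Fin.castAdd k i) = tailSum c i + ∑ j, d j := by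
  have h : ∀ j : Fin k, Fin.castAdd k i ≤ Fin.natAdd r j := fun j => by
    simp only [Fin.le_def, Fin.val_castAdd, Fin.val_natAdd]; omega
  have h' : ∀ j : Fin r, Fin.castAdd k i ≤ Fin.castAdd k j ↔ i ≤ j := fun j => Iff.rfl
  simp only [tailSum, Fin.sum_univ_add, Fin.append_left, Fin.append_right, h, h', if_true]

lemma tailSum_append_natAdd {r k : ℕ} (c : Fin r → ℝ) (d : Fin k → ℝ) (i : Fin k) :
    tailSum (Fin.append c d) (Fin.natAdd r i) = tailSum d i := by
  have h : ∀ j : Fin r, ¬ Fin.natAdd r i ≤ Fin.castAdd k j := fun j => by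
    simp only [Fin.le_def, Fin.val_castAdd, Fin.val_natAdd]; omega
  have h' : ∀ j : Fin k, Fin.natAdd r i ≤ Fin.natAdd r j ↔ i ≤ j :=
    fun j => Nat.add_le_add_iff_left
  simp [tailSum, Fin.sum_univ_add, h, h']

lemma tailSum_snoc_castSucc {r : ℕ} (c : Fin r → ℝ) (x : ℝ) (i : Fin r) :
    tailSum (Fin.snoc c x : Fin (r + 1) → ℝ) i.castSucc = tailSum c i + x := by
  simp [tailSum, Fin.sum_univ_castSucc, Fin.le_last]

lemma tailSum_snoc_last {r : ℕ} (c : Fin r → ℝ) (x : ℝ) :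
    tailSum (Fin.snoc c x : Fin (r + 1) → ℝ) (Fin.last r) = x := by
  simp [tailSum]

lemma sum_mul_nonneg_of_tailSum_nonneg {r : ℕ} (c : Fin r → ℝ) (hc : ∀ i, 0 ≤ tailSum c i)
    (n : Fin r → ℝ) (hn : Monotone n) (h0 : ∀ i, 0 ≤ n i) : 0 ≤ ∑ j, c j * n j := by
  induction r with
  | zero => simp
  | succ r ih =>
    have h1 := ih (fun j => c j.succ) (fun i => tailSum_succ c i ▸ hc i.succ)
      (fun j => n j.succ - n 0)
      (fun i j hij => sub_le_sub_right (hn (Fin.succ_le_succ_iff.2 hij)) _)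
      (fun i => sub_nonneg.2 (hn (Fin.zero_le _)))
    have h2 := mul_nonneg (tailSum_zero c ▸ hc 0) (h0 0)
    rw [Fin.sum_univ_succ] at h2 ⊢
    simp only [mul_sub, Finset.sum_sub_distrib, ← Finset.sum_mul] at h1
    linarith

lemma summable_prod_pow_fin (r : ℕ) {ρ : ℝ} (h0 : 0 ≤ ρ) (h1 : ρ < 1) :
    Summable (fun n : Fin r → ℕ => ∏ j, ρ ^ n j) := by
  induction r with
  | zero => exact Summable.of_finite
  | succ r ih =>
    rw [← (Fin.consEquiv (fun _ => ℕ)).summable_iff]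
    refine ((summable_geometric_of_lt_one h0 h1).mul_of_nonneg ih (fun n => pow_nonneg h0 n)
      (fun n => Finset.prod_nonneg fun j _ => pow_nonneg h0 _)).congr fun x => ?_
    simp [Fin.consEquiv, Fin.prod_univ_succ]

lemma summable_prod_rpow_qIdx {q : ℝ} (hq0 : 0 < q) (hq1 : q < 1) {r : ℕ} (c : Fin r → ℝ)
    (hc : ∀ i, 0 < tailSum c i) :
    Summable (fun n : qIdx r => ∏ j, q ^ (c j * (n.1 j : ℝ))) := by
  obtain ⟨ε, hε, hcε⟩ : ∃ ε : ℝ, 0 < ε ∧ ∀ i, 0 ≤ tailSum (fun j => c j - ε) i := by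
    obtain ⟨t, ht, htc⟩ : ∃ t : ℝ, 0 < t ∧ ∀ i, t ≤ tailSum c i := by
      rcases isEmpty_or_nonempty (Fin r) with h | h
      · exact ⟨1, one_pos, fun i => h.elim i⟩
      · obtain ⟨i, hi⟩ := Finite.exists_min (tailSum c)
        exact ⟨_, hc i, hi⟩
    refine ⟨t / (r + 1), by positivity, fun i => ?_⟩
    have h : tailSum c i - ∑ _j : Fin r, t / (r + 1 : ℝ) ≤ tailSum (fun j => c j - t / (r + 1)) i := by
      rw [tailSum, tailSum, ← Finset.sum_sub_distrib]
      refine Finset.sum_le_sum fun j _ => ?_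
      have : 0 ≤ t / (r + 1 : ℝ) := by positivity
      split_ifs <;> linarith
    have h' : ∑ _j : Fin r, t / (r + 1 : ℝ) ≤ t := by
      rw [Finset.sum_const, Finset.card_univ, Fintype.card_fin, nsmul_eq_mul, mul_div_assoc',
        div_le_iff₀ (by positivity)]
      nlinarith
    linarith [htc i]
  have hS := (summable_prod_pow_fin r (Real.rpow_nonneg hq0.le ε)
    (Real.rpow_lt_one hq0.le hq1 hε)).comp_injective
    (show Function.Injective (fun n : qIdx r => n.1) from Subtype.val_injective)
  refine hS.of_nonneg_of_le (fun n => Finset.prod_nonneg fun j _ => Real.rpow_nonneg hq0.le _)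
    fun n => ?_
  have h := sum_mul_nonneg_of_tailSum_nonneg _ hcε (fun j => (n.1 j : ℝ))
    (fun i j hij => Nat.cast_le.2 (n.2.1.monotone hij)) (fun i => Nat.cast_nonneg _)
  simp only [sub_mul, Finset.sum_sub_distrib] at h
  simp only [Function.comp, ← Real.rpow_natCast, ← Real.rpow_mul hq0.le]
  rw [← Real.rpow_sum_of_pos hq0, ← Real.rpow_sum_of_pos hq0]
  exact Real.rpow_le_rpow_of_exponent_ge hq0 hq1.le (by linarith)

lemma one_le_qnum {q : ℝ} (hq0 : 0 < q) (hq1 : q < 1) {n : ℕ} (hn : 0 < n) : 1 ≤ qnum q n := by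
  rw [qnum, one_le_div (sub_pos.2 hq1)]
  linarith [pow_le_of_le_one hq0.le hq1.le hn.ne']

lemma qnum_le {q : ℝ} (hq0 : 0 < q) (hq1 : q < 1) (n : ℕ) : qnum q n ≤ (1 - q)⁻¹ := by
  rw [qnum, ← one_div]
  exact div_le_div_of_nonneg_right (by linarith [pow_pos hq0 n]) (sub_pos.2 hq1).le

lemma qnum_mono {q : ℝ} (hq0 : 0 < q) (hq1 : q < 1) : Monotone (qnum q) := fun _ _ h =>
  div_le_div_of_nonneg_right (sub_le_sub_left (pow_le_pow_of_le_one hq0.le hq1.le h) _)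
    (sub_pos.2 hq1).le

/-- The absolute value of one factor of the `q`-multiple zeta series. -/
noncomputable def factorNorm (q : ℝ) (σ : ℝ) (n : ℕ) : ℝ :=
  q ^ ((σ - 1) * (n : ℝ)) / qnum q n ^ σ

lemma norm_zetaTerm {q : ℝ} (hq0 : 0 < q) (hq1 : q < 1) {r : ℕ} (s : Fin r → ℂ) (n : qIdx r) :
    ‖zetaTerm q s n.1‖ = ∏ j, factorNorm q (s j).re (n.1 j) := by
  rw [zetaTerm, norm_prod]
  refine Finset.prod_congr rfl fun j _ => ?_
  rw [norm_div, Complex.norm_cpow_eq_rpow_re_of_pos hq0,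
    Complex.norm_cpow_eq_rpow_re_of_pos (one_pos.trans_le (one_le_qnum hq0 hq1 (n.2.2 j)))]
  simp [factorNorm]

lemma factorNorm_nonneg {q : ℝ} (hq0 : 0 < q) (hq1 : q < 1) (σ : ℝ) {n : ℕ} (hn : 0 < n) :
    0 ≤ factorNorm q σ n :=
  div_nonneg (Real.rpow_nonneg hq0.le _)
    (Real.rpow_nonneg (zero_le_one.trans (one_le_qnum hq0 hq1 hn)) _)

lemma factorNorm_le {q : ℝ} (hq0 : 0 < q) (hq1 : q < 1) (σ : ℝ) {n : ℕ} (hn : 0 < n) :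
    factorNorm q σ n ≤ ((1 - q)⁻¹) ^ |σ| * q ^ ((σ - 1) * (n : ℝ)) := by
  have h1 := one_le_qnum hq0 hq1 hn
  rw [factorNorm, div_eq_mul_inv, ← Real.rpow_neg (zero_le_one.trans h1), mul_comm]
  refine mul_le_mul_of_nonneg_right ?_ (Real.rpow_nonneg hq0.le _)
  exact (Real.rpow_le_rpow_of_exponent_le h1 (neg_le_abs σ)).trans
    (Real.rpow_le_rpow (zero_le_one.trans h1) (qnum_le hq0 hq1 n) (abs_nonneg σ))

lemma factorNorm_add_natCast {q : ℝ} (hq0 : 0 < q) (hq1 : q < 1) (σ : ℝ) (k : ℕ) {n : ℕ}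
    (hn : 0 < n) :
    factorNorm q (σ + k) n = factorNorm q σ n * (q ^ n / qnum q n) ^ k := by
  have h1 := one_pos.trans_le (one_le_qnum hq0 hq1 hn)
  have h2 : (σ + k - 1) * (n : ℝ) = (σ - 1) * n + ((n * k : ℕ) : ℝ) := by push_cast; ring
  rw [factorNorm, factorNorm, h2, Real.rpow_add hq0, Real.rpow_add h1, Real.rpow_natCast,
    Real.rpow_natCast, pow_mul, div_pow, mul_div_mul_comm]

lemma summable_norm_zetaTerm {q : ℝ} (hq0 : 0 < q) (hq1 : q < 1) {r : ℕ} (s : Fin r → ℂ)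
    (hs : ∀ i, 0 < tailSum (fun j => (s j).re - 1) i) :
    Summable (fun n : qIdx r => ‖zetaTerm q s n.1‖) := by
  refine ((summable_prod_rpow_qIdx hq0 hq1 _ hs).mul_left
    (∏ j, ((1 - q)⁻¹) ^ |(s j).re|)).of_nonneg_of_le (fun n => norm_nonneg _) fun n => ?_
  rw [norm_zetaTerm hq0 hq1, ← Finset.prod_mul_distrib]
  exact Finset.prod_le_prod (fun j _ => factorNorm_nonneg hq0 hq1 _ (n.2.2 j))
    fun j _ => factorNorm_le hq0 hq1 _ (n.2.2 j)

/-- The tuples of `b + 1` positive integers with sum `N` whose last entry is at least `2`. -/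
def admissible (b N : ℕ) : Finset (Fin (b + 1) → ℕ) :=
  (Finset.Nat.antidiagonalTuple (b + 1) N).filter
    fun m => (∀ i, 1 ≤ m i) ∧ 2 ≤ m (Fin.last b)

lemma mem_admissible {b N : ℕ} {m : Fin (b + 1) → ℕ} :
    m ∈ admissible b N ↔ ∑ i, m i = N ∧ (∀ i, 1 ≤ m i) ∧ 2 ≤ m (Fin.last b) := by
  rw [admissible, Finset.mem_filter, Finset.Nat.mem_antidiagonalTuple]

/-- The smallest admissible tuple `(1, …, 1, 2)`. -/
def minTuple (b : ℕ) : Fin (b + 1) → ℕ := Fin.snoc (fun _ => 1) 2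

lemma sum_minTuple (b : ℕ) : ∑ i, minTuple b i = b + 2 := by
  simp [minTuple, Fin.sum_univ_castSucc]

lemma minTuple_mem_admissible (b : ℕ) : minTuple b ∈ admissible b (b + 2) := by
  refine mem_admissible.2 ⟨sum_minTuple b, ?_, by simp [minTuple]⟩
  simp [Fin.forall_fin_succ', minTuple]

lemma minTuple_le {b N : ℕ} {m : Fin (b + 1) → ℕ} (hm : m ∈ admissible b N) (i : Fin (b + 1)) :
    minTuple b i ≤ m i := by
  obtain ⟨-, h1, h2⟩ := mem_admissible.1 hm
  induction i using Fin.lastCases with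
  | last => simpa [minTuple] using h2
  | cast i => simpa [minTuple] using h1 i.castSucc

lemma le_of_mem_admissible {b N : ℕ} {m : Fin (b + 1) → ℕ} (hm : m ∈ admissible b N) :
    b + 2 ≤ N := by
  rw [← sum_minTuple, ← (mem_admissible.1 hm).1]
  exact Finset.sum_le_sum fun i _ => minTuple_le hm i

lemma card_admissible_le (b N : ℕ) : (admissible b N).card ≤ (N + 1) ^ (b + 1) := by
  have h : admissible b N ⊆ Fintype.piFinset fun _ => Finset.range (N + 1) := by
    intro m hm
    rw [Fintype.mem_piFinset]
    intro i
    rw [Finset.mem_range, Nat.lt_succ_iff, ← (mem_admissible.1 hm).1]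
    exact Finset.single_le_sum (fun j _ => Nat.zero_le (m j)) (Finset.mem_univ i)
  simpa using Finset.card_le_card h

lemma sum_admissible_succ {M : Type*} [AddCommMonoid M] (b S : ℕ)
    (F : (Fin (b + 2) → ℕ) → M) :
    ∑ m ∈ admissible (b + 1) S, F m =
      ∑ N ∈ Finset.range S, ∑ m ∈ admissible b N, F (Fin.cons (S - N) m) := by
  rw [Finset.sum_sigma']
  refine Finset.sum_bij' (fun m _ => ⟨∑ i : Fin (b + 1), m i.succ, fun i => m i.succ⟩)
    (fun x _ => Fin.cons (S - x.1) x.2) ?_ ?_ ?_ ?_ ?_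
  · intro m hm
    obtain ⟨h, h1, h2⟩ := mem_admissible.1 hm
    rw [Fin.sum_univ_succ] at h
    have h0 := h1 0
    exact Finset.mem_sigma.2 ⟨Finset.mem_range.2 (by dsimp only; omega),
      mem_admissible.2 ⟨rfl, fun i => h1 i.succ, h2⟩⟩
  · rintro ⟨N, m⟩ hx
    obtain ⟨hN, hm⟩ := Finset.mem_sigma.1 hx
    obtain ⟨h, h1, h2⟩ := mem_admissible.1 hm
    have hN := Finset.mem_range.1 hN
    dsimp only at h h1 h2 hN
    refine mem_admissible.2 ⟨?_, ?_, ?_⟩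
    · simp only [Fin.sum_univ_succ (n := b + 1), Fin.cons_zero, Fin.cons_succ, h]
      omega
    · rw [Fin.forall_fin_succ]
      exact ⟨by simp only [Fin.cons_zero]; omega, fun i => by simpa using h1 i⟩
    · rwa [← Fin.succ_last, Fin.cons_succ]
  · intro m hm
    obtain ⟨h, -, -⟩ := mem_admissible.1 hm
    rw [Fin.sum_univ_succ] at h
    funext i
    refine Fin.cases ?_ (fun i => ?_) i
    · simp only [Fin.cons_zero]; omega
    · simp
  · rintro ⟨N, m⟩ hx
    obtain ⟨-, hm⟩ := Finset.mem_sigma.1 hx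
    simp [(mem_admissible.1 hm).1]
  · intro m hm
    obtain ⟨h, -, -⟩ := mem_admissible.1 hm
    rw [Fin.sum_univ_succ] at h
    congr 1
    funext i
    refine Fin.cases ?_ (fun i => ?_) i
    · simp only [Fin.cons_zero]; omega
    · simp

lemma qMZF_comp_cast (q : ℝ) {r r' : ℕ} (h : r = r') (s : Fin r' → ℂ) :
    qMZF q (s ∘ Fin.cast h) = qMZF q s := by
  subst h
  rfl

lemma summable_norm_zetaTerm_append {q : ℝ} (hq0 : 0 < q) (hq1 : q < 1) {a b N : ℕ}
    (sv : Fin a → ℂ) (hsv : ∀ i, 0 < tailSum (fun j => (sv j).re - 1) i + N - (b + 1))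
    {m : Fin (b + 1) → ℕ} (hm : m ∈ admissible b N) :
    Summable (fun n : qIdx (a + (b + 1)) =>
      ‖zetaTerm q (Fin.append sv (fun i => (m i : ℂ))) n.1‖) := by
  refine summable_norm_zetaTerm hq0 hq1 _ ?_
  obtain ⟨h, h1, h2⟩ := mem_admissible.1 hm
  have he : (fun j => (Fin.append sv (fun i => (m i : ℂ)) j).re - 1) =
      Fin.append (fun j => (sv j).re - 1) (fun i => (m i : ℝ) - 1) := by
    funext j
    refine Fin.addCases (fun j => ?_) (fun j => ?_) j <;> simp
  rw [he, Fin.forall_fin_add]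
  refine ⟨fun i => ?_, fun i => ?_⟩
  · rw [tailSum_append_castAdd]
    have h3 : ∑ j, ((m j : ℝ) - 1) = N - (b + 1) := by
      rw [Finset.sum_sub_distrib, ← Nat.cast_sum, h]
      simp
    linarith [hsv i]
  · rw [tailSum_append_natAdd, tailSum]
    have hpos : ∀ j, 0 ≤ (m j : ℝ) - 1 := fun j => sub_nonneg.2 (Nat.one_le_cast.2 (h1 j))
    refine Finset.sum_pos' (fun j _ => ?_) ⟨Fin.last b, Finset.mem_univ _, ?_⟩
    · split_ifs
      exacts [hpos j, le_rfl]
    · rw [if_pos (Fin.le_last i)]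
      have : (2 : ℝ) ≤ m (Fin.last b) := by exact_mod_cast h2
      linarith

lemma norm_zetaTerm_append_le {q : ℝ} (hq0 : 0 < q) (hq1 : q < 1) {a b S N K : ℕ}
    (hN : N = b + 2 + K) (sv : Fin a → ℂ) {m : Fin (b + 1) → ℕ} (hm : m ∈ admissible b N)
    (n : qIdx (a + 1 + (b + 1))) :
    ‖zetaTerm q (Fin.append (Fin.snoc sv ((S : ℂ) - N) : Fin (a + 1) → ℂ)
        (fun i => (m i : ℂ))) n.1‖ ≤
      q ^ K * ‖zetaTerm q (Fin.append (Fin.snoc sv ((S : ℂ) - (b + 2 : ℕ)) : Fin (a + 1) → ℂ)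
        (fun i => (minTuple b i : ℂ))) n.1‖ := by
  obtain ⟨k, hk⟩ : ∃ k : Fin (b + 1) → ℕ, ∀ i, m i = minTuple b i + k i :=
    ⟨fun i => m i - minTuple b i, fun i => (Nat.add_sub_cancel' (minTuple_le hm i)).symm⟩
  have hkK : ∑ i, k i = K := by
    have h := (mem_admissible.1 hm).1
    simp only [hk, Finset.sum_add_distrib, sum_minTuple] at h
    omega
  rw [norm_zetaTerm hq0 hq1, norm_zetaTerm hq0 hq1, Fin.prod_univ_add (a := a + 1),
    Fin.prod_univ_add (a := a + 1),
    Fin.prod_univ_castSucc (n := a), Fin.prod_univ_castSucc (n := a)]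
  simp only [Fin.append_left, Fin.append_right, Fin.snoc_castSucc, Fin.snoc_last,
    Complex.sub_re, Complex.natCast_re]
  set n₀ := n.1 (Fin.castAdd (b + 1) (Fin.last a)) with hn₀
  have hpos := n.2.2
  have hS : ((S : ℝ) - (b + 2 : ℕ)) = ((S : ℝ) - N) + K := by
    rw [hN]; push_cast; ring
  rw [hS, factorNorm_add_natCast hq0 hq1 _ _ (hpos _)]
  have hm' : ∀ i, factorNorm q (m i) (n.1 (Fin.natAdd (a + 1) i)) =
      factorNorm q (minTuple b i) (n.1 (Fin.natAdd (a + 1) i)) *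
        (q ^ n.1 (Fin.natAdd (a + 1) i) / qnum q (n.1 (Fin.natAdd (a + 1) i))) ^ k i := fun i => by
    rw [hk, Nat.cast_add, factorNorm_add_natCast hq0 hq1 _ _ (hpos _)]
  simp only [hm', Finset.prod_mul_distrib]
  have hx : ∏ i, (q ^ n.1 (Fin.natAdd (a + 1) i) / qnum q (n.1 (Fin.natAdd (a + 1) i))) ^ k i ≤
      (q * (q ^ n₀ / qnum q n₀)) ^ K := by
    rw [← hkK, ← Finset.prod_pow_eq_pow_sum]
    have hq' : ∀ j, 0 < qnum q (n.1 j) := fun j => one_pos.trans_le (one_le_qnum hq0 hq1 (hpos j))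
    refine Finset.prod_le_prod (fun i _ => pow_nonneg (div_nonneg (pow_nonneg hq0.le _)
      (hq' _).le) _) fun i _ => pow_le_pow_left₀ (div_nonneg (pow_nonneg hq0.le _)
      (hq' _).le) ?_ _
    have hlt : n₀ < n.1 (Fin.natAdd (a + 1) i) := n.2.1 (by
      simp only [Fin.lt_def, Fin.val_castAdd, Fin.val_natAdd, Fin.val_last]; omega)
    rw [mul_div_assoc', ← pow_succ']
    exact div_le_div₀ (pow_nonneg hq0.le _) (pow_le_pow_of_le_one hq0.le hq1.le hlt) (hq' _)
      (qnum_mono hq0 hq1 hlt.le)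
  refine (mul_le_mul_of_nonneg_left (mul_le_mul_of_nonneg_left hx
    (Finset.prod_nonneg fun i _ => factorNorm_nonneg hq0 hq1 _ (hpos _)))
    (mul_nonneg (Finset.prod_nonneg fun i _ => factorNorm_nonneg hq0 hq1 _ (hpos _))
      (factorNorm_nonneg hq0 hq1 _ (hpos _)))).trans_eq ?_
  rw [mul_pow]
  ring

/-- The sum of `ζ_q(s₁,…,s_a,S-N,m)` over the admissible tuples `m` with sum `N`. -/
noncomputable def fiberSum (q : ℝ) {a : ℕ} (b S : ℕ) (sv : Fin a → ℂ) (N : ℕ) : ℂ :=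
  ∑ m ∈ admissible b N,
    qMZF q (Fin.append (Fin.snoc sv ((S : ℂ) - N) : Fin (a + 1) → ℂ) (fun i => (m i : ℂ)))

lemma tailSum_snoc_sub_pos {a b S : ℕ} (hS : b + 2 < S) (sv : Fin a → ℂ)
    (hsv : ∀ i, 0 < tailSum (fun j => (sv j).re - 1) i + S - (b + 2)) (N : ℕ) (i : Fin (a + 1)) :
    0 < tailSum (fun j => ((Fin.snoc sv ((S : ℂ) - N) : Fin (a + 1) → ℂ) j).re - 1) i
      + N - (b + 1) := by
  have he : (fun j => ((Fin.snoc sv ((S : ℂ) - N) : Fin (a + 1) → ℂ) j).re - 1) =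
      (Fin.snoc (fun j => (sv j).re - 1) ((S : ℝ) - N - 1) : Fin (a + 1) → ℝ) := by
    funext j
    refine Fin.lastCases ?_ (fun j => ?_) j <;> simp
  rw [he]
  refine Fin.lastCases ?_ (fun i => ?_) i
  · rw [tailSum_snoc_last]
    have : (b : ℝ) + 2 < S := by exact_mod_cast hS
    linarith
  · rw [tailSum_snoc_castSucc]
    linarith [hsv i]

lemma exists_norm_qMZF_append_le {q : ℝ} (hq0 : 0 < q) (hq1 : q < 1) {a b S : ℕ}
    (hS : b + 2 < S) (sv : Fin a → ℂ)
    (hsv : ∀ i, 0 < tailSum (fun j => (sv j).re - 1) i + S - (b + 2)) :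
    ∃ Z : ℝ, 0 ≤ Z ∧ ∀ N K : ℕ, N = b + 2 + K → ∀ m ∈ admissible b N,
      ‖qMZF q (Fin.append (Fin.snoc sv ((S : ℂ) - N) : Fin (a + 1) → ℂ)
        (fun i => (m i : ℂ)))‖ ≤ q ^ K * Z := by
  have hZ := summable_norm_zetaTerm_append hq0 hq1 _ (tailSum_snoc_sub_pos hS sv hsv (b + 2))
    (minTuple_mem_admissible b)
  exact ⟨_, tsum_nonneg fun n => norm_nonneg _, fun N K hK m hm =>
    tsum_of_norm_bounded (hZ.hasSum.mul_left (q ^ K))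
      fun n => norm_zetaTerm_append_le hq0 hq1 hK sv hm n⟩

lemma summable_fiberSum {q : ℝ} (hq0 : 0 < q) (hq1 : q < 1) {a b S : ℕ} (hS : b + 2 < S)
    (sv : Fin a → ℂ) (hsv : ∀ i, 0 < tailSum (fun j => (sv j).re - 1) i + S - (b + 2)) :
    Summable (fiberSum q b S sv) := by
  obtain ⟨Z, hZ, hle⟩ := exists_norm_qMZF_append_le hq0 hq1 hS sv hsv
  have hgeo : Summable fun N : ℕ => ((N + 1 : ℕ) : ℝ) ^ (b + 1) * q ^ (N + 1) :=
    (summable_nat_add_iff (f := fun N : ℕ => (N : ℝ) ^ (b + 1) * q ^ N) 1).2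
      (summable_pow_mul_geometric_of_norm_lt_one (b + 1)
        (show ‖q‖ < 1 by rwa [Real.norm_of_nonneg hq0.le]))
  refine (hgeo.mul_right (Z / q ^ (b + 3))).of_norm_bounded fun N => ?_
  have hterm : ∀ m ∈ admissible b N, ‖qMZF q (Fin.append
      (Fin.snoc sv ((S : ℂ) - N) : Fin (a + 1) → ℂ) (fun i => (m i : ℂ)))‖ ≤
        q ^ (N + 1) * (Z / q ^ (b + 3)) := by
    intro m hm
    obtain ⟨K, hK⟩ := Nat.exists_eq_add_of_le (le_of_mem_admissible hm)
    refine (hle N K hK m hm).trans_eq ?_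
    have : q ^ (N + 1) = q ^ K * q ^ (b + 3) := by rw [hK, ← pow_add]; congr 1; omega
    rw [this]
    field_simp
  calc ‖fiberSum q b S sv N‖ ≤ (admissible b N).card • (q ^ (N + 1) * (Z / q ^ (b + 3))) :=
        (norm_sum_le _ _).trans (Finset.sum_le_card_nsmul _ _ _ hterm)
    _ ≤ ((N + 1 : ℕ) : ℝ) ^ (b + 1) * (q ^ (N + 1) * (Z / q ^ (b + 3))) := by
        rw [nsmul_eq_mul]
        refine mul_le_mul_of_nonneg_right (by exact_mod_cast card_admissible_le b N) ?_
        positivity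
    _ = ((N + 1 : ℕ) : ℝ) ^ (b + 1) * q ^ (N + 1) * (Z / q ^ (b + 3)) := (mul_assoc _ _ _).symm

lemma Gq_eq_sum_admissible {q : ℝ} (hq0 : 0 < q) (hq1 : q < 1) (b a S : ℕ) (hS : b + 1 < S)
    (sv : Fin a → ℂ) (hsv : ∀ i, 0 < tailSum (fun j => (sv j).re - 1) i + S - (b + 1)) :
    Gq q (b + 1) a sv S =
      ∑ m ∈ admissible b S, qMZF q (Fin.append sv (fun i => (m i : ℂ))) := by
  induction b generalizing a S with
  | zero =>
    have h : admissible 0 S = {fun _ => S} := by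
      ext m
      rw [mem_admissible, Finset.mem_singleton]
      constructor
      · rintro ⟨h, -⟩
        funext i
        rw [Subsingleton.elim (α := Fin 1) i 0]
        simpa using h
      · rintro rfl
        exact ⟨by simp, fun _ => show 1 ≤ S by omega, show 2 ≤ S by omega⟩
    rw [h, Finset.sum_singleton, Fin.append_right_eq_snoc]
    rfl
  | succ b ih =>
    have hS' : b + 2 < S := hS
    have hsv' : ∀ i, 0 < tailSum (fun j => (sv j).re - 1) i + S - (b + 2) := fun i => by
      have := hsv i
      push_cast at this
      linarith
    have hfib : ∀ N, b + 1 < N →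
        Gq q (b + 1) (a + 1) (Fin.snoc sv ((S : ℂ) - N)) N = fiberSum q b S sv N :=
      fun N hN => ih (a + 1) N hN _ (tailSum_snoc_sub_pos hS' sv hsv' N)
    have hsum := summable_fiberSum hq0 hq1 hS' sv hsv'
    have h1 : ∀ n : ℕ, Gq q (b + 1) (a + 1)
        (Fin.snoc sv ((S : ℂ) - (n : ℂ) - ((b : ℂ) + 2))) ((n : ℂ) + ((b : ℂ) + 2)) =
          fiberSum q b S sv (n + (b + 2)) := fun n => by
      rw [← hfib _ (by omega), sub_sub]
      push_cast
      rfl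
    have h2 : ∀ n : ℕ, Gq q (b + 1) (a + 1) (Fin.snoc sv (-(n : ℂ))) ((S : ℂ) + (n : ℂ)) =
        fiberSum q b S sv (n + S) := fun n => by
      rw [← hfib _ (by omega)]
      push_cast
      rw [add_comm (n : ℂ), sub_add_cancel_left]
    have h0 : ∑ N ∈ Finset.range (b + 2), fiberSum q b S sv N = 0 := by
      refine Finset.sum_eq_zero fun N hN => Finset.sum_eq_zero fun m hm => ?_
      exact absurd (Finset.mem_range.1 hN) (not_lt.2 (le_of_mem_admissible hm))
    have e1 := hsum.sum_add_tsum_nat_add (b + 2)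
    have e2 := hsum.sum_add_tsum_nat_add S
    rw [h0, zero_add, ← e2] at e1
    rw [Gq, tsum_congr h1, tsum_congr h2, e1, add_sub_cancel_right, sum_admissible_succ]
    refine Finset.sum_congr rfl fun N hN => Finset.sum_congr rfl fun m _ => ?_
    have hc : (fun i => ((Fin.cons (S - N) m : Fin (b + 2) → ℕ) i : ℂ)) =
        Fin.cons ((S : ℂ) - N) (fun i => (m i : ℂ)) := by
      funext i
      refine Fin.cases ?_ (fun i => ?_) i
      · simp [Nat.cast_sub (Finset.mem_range.1 hN).le]
      · simp
    rw [hc, Fin.append_right_cons, qMZF_comp_cast]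

/-- For an integer `s > b`, `G_q^{(a,b)}(s₁,…,s_a;s)` equals the sum of
`ζ_q(s₁,…,s_a,m₁,…,m_b)` over all tuples of positive integers with `m₁+⋯+m_b = s`
and `m_b ≥ 2`, each `ζ_q` being given by its absolutely convergent series. -/
theorem Gq_integer_value (q : ℝ) (hq0 : 0 < q) (hq1 : q < 1)
    (a b : ℕ) (hb : 1 ≤ b) (s : ℤ) (hs : (b : ℤ) < s) (sv : Fin a → ℂ)
    (hsv : ∀ k : ℕ, 1 ≤ k → k ≤ a →
      ((k + b : ℕ) : ℝ) <
        ((s : ℂ) + ∑ j ∈ Finset.univ.filter (fun j : Fin a => a - k ≤ (j : ℕ)), sv j).re) :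
    (∀ m : Fin b → ℕ, (∀ i, 1 ≤ m i) → (∑ i, (m i : ℤ)) = s → 2 ≤ m ⟨b - 1, by omega⟩ →
      Summable (fun n : qIdx (a + b) =>
        zetaTerm q (Fin.append sv (fun i => (m i : ℂ))) n.1)) ∧
    Gq q b a sv (s : ℂ) =
      ∑' m : {m : Fin b → ℕ // (∀ i, 1 ≤ m i) ∧ (∑ i, (m i : ℤ)) = s ∧
          2 ≤ m ⟨b - 1, by omega⟩},
        qMZF q (Fin.append sv (fun i => ((m.1 i : ℕ) : ℂ))) := by
  obtain ⟨b, rfl⟩ : ∃ b', b = b' + 1 := ⟨b - 1, by omega⟩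
  obtain ⟨S, rfl⟩ : ∃ S : ℕ, s = S := ⟨s.toNat, by omega⟩
  have hS : b + 1 < S := by exact_mod_cast hs
  have hT : ∀ i, 0 < tailSum (fun j => (sv j).re - 1) i + S - (b + 1) := by
    intro i
    have h := hsv (a - i) (by omega) (by omega)
    have hi : a - (a - (i : ℕ)) = i := by omega
    rw [hi, Complex.add_re, Complex.re_sum, Finset.sum_filter] at h
    have hcard : (∑ j : Fin a, if (i : ℕ) ≤ j then (1 : ℝ) else 0) = ((a - i : ℕ) : ℝ) := by
      rw [Finset.sum_boole, ← Fin.card_Ici]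
      congr 2
      ext j
      simp only [Finset.mem_filter, Finset.mem_univ, true_and, Finset.mem_Ici, Fin.le_def]
    have ht : tailSum (fun j => (sv j).re - 1) i =
        (∑ j : Fin a, if (i : ℕ) ≤ j then (sv j).re else 0) - ((a - i : ℕ) : ℝ) := by
      rw [← hcard, ← Finset.sum_sub_distrib, tailSum]
      refine Finset.sum_congr rfl fun j _ => ?_
      simp only [Fin.le_def]
      split_ifs <;> simp
    rw [ht]
    push_cast at h
    simp only [Complex.natCast_re] at h
    linarith
  have hmem : ∀ m : Fin (b + 1) → ℕ, m ∈ admissible b S ↔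
      (∀ i, 1 ≤ m i) ∧ (∑ i, (m i : ℤ)) = S ∧ 2 ≤ m ⟨b + 1 - 1, by omega⟩ := by
    intro m
    rw [mem_admissible, ← Nat.cast_sum, Nat.cast_inj]
    exact and_left_comm
  refine ⟨fun m h1 h2 h3 => ?_, ?_⟩
  · exact (summable_norm_zetaTerm_append hq0 hq1 sv hT ((hmem m).2 ⟨h1, h2, h3⟩)).of_norm
  · rw [Int.cast_natCast, Gq_eq_sum_admissible hq0 hq1 b a S hS sv hT, ← Finset.tsum_subtype]
    exact (Equiv.subtypeEquivRight hmem).tsum_eq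
      (fun m => qMZF q (Fin.append sv (fun i => ((m.1 i : ℕ) : ℂ))))
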